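/- The 16 elementary questions are exactly the atoms of the logic L: (i) each elementary question e is an atom, i.e. e ≠ 0 and every f ∈ L with f(P) ≤ e(P) for all P ∈ S satisfies f = 0 or f = e; (ii) distinct elementary questions are incomparable, i.e. for elementary e ≠ e' neither e ≤ e' nor e' ≤ e holds pointwise on S; (iii) every atom of L is an elementary question. -/

import Mathlib

namespace BoxWorld

/-- A (2,2)-box assignment: `P a b α β` stands for `P(αβ|ab)`, where the measurement
settings are `a, b ∈ Fin 2` (with `x = 0`, `y = 1`) and the outcomes are `α, β ∈ Fin 2`. -/
abbrev Box : Type := Fin 2 → Fin 2 → Fin 2 → Fin 2 → ℝ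

/-- (P1) positivity, (P2) normalization, (P3) non-signalling. -/
def IsState (P : Box) : Prop :=
  (∀ a b α β, 0 ≤ P a b α β) ∧
  (∀ a b, ∑ α : Fin 2, ∑ β : Fin 2, P a b α β = 1) ∧
  (∀ a b b' α, ∑ β : Fin 2, P a b α β = ∑ β : Fin 2, P a b' α β) ∧
  (∀ a a' b β, ∑ α : Fin 2, P a b α β = ∑ α : Fin 2, P a' b α β)

/-- The set `S` of (2,2)-box states, as a subtype. -/
abbrev State : Type := {P : Box // IsState P}

/-- The elementary question `e[ab, αβ]`, as a functional on states. -/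
def elem (a b α β : Fin 2) : State → ℝ := fun P => P.1 a b α β

abbrev Idx : Type := Fin 2 × Fin 2 × Fin 2 × Fin 2

def elemI (i : Idx) : State → ℝ := elem i.1 i.2.1 i.2.2.1 i.2.2.2

/-- The logic `L` of the (2,2)-box world: all functionals `f = Σ_{e ∈ A} e`, where `A` is a
set of elementary questions whose pointwise sum is `≤ 1` at every state, together with the
complements `1 - f` of all such functionals. -/
def InLogic (f : State → ℝ) : Prop :=
  (∃ A : Finset Idx, (∀ P : State, ∑ i ∈ A, elemI i P ≤ 1) ∧
      f = fun P => ∑ i ∈ A, elemI i P) ∨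
  (∃ A : Finset Idx, (∀ P : State, ∑ i ∈ A, elemI i P ≤ 1) ∧
      f = fun P => 1 - ∑ i ∈ A, elemI i P)

/-- A functional is an elementary question if it equals some `e[ab,αβ]`. -/
def IsElem (f : State → ℝ) : Prop := ∃ a b α β : Fin 2, f = elem a b α β

/-- The deterministic state with outcome `u a` for setting `a` and `v b` for setting `b`. -/
def detState (u v : Fin 2 → Fin 2) : State :=
  ⟨fun a b α β => (if u a = α then 1 else 0) * (if v b = β then 1 else 0), by
    refine ⟨fun a b α β => ?_, fun a b => ?_, fun a b b' α => ?_, fun a a' b β => ?_⟩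
    · positivity
    · simp
    · simp
    · simp⟩

lemma elemI_detState (u v : Fin 2 → Fin 2) (i : Idx) :
    elemI i (detState u v) = if u i.1 = i.2.2.1 ∧ v i.2.1 = i.2.2.2 then 1 else 0 := by
  simp only [elemI, elem, detState]
  split_ifs <;> simp_all

lemma elemI_nonneg (i : Idx) (P : State) : 0 ≤ elemI i P := P.2.1 _ _ _ _

lemma eq_of_elemI_le {i j : Idx} (h : ∀ P : State, elemI i P ≤ elemI j P) : i = j := by
  have hsep : ∀ i j : Idx, i ≠ j → ∃ p q r s : Fin 2,
      (![p, q] i.1 = i.2.2.1 ∧ ![r, s] i.2.1 = i.2.2.2) ∧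
        ¬(![p, q] j.1 = j.2.2.1 ∧ ![r, s] j.2.1 = j.2.2.2) := by decide
  by_contra hij
  obtain ⟨p, q, r, s, h1, h2⟩ := hsep i j hij
  have := h (detState ![p, q] ![r, s])
  rw [elemI_detState, elemI_detState, if_pos h1, if_neg h2] at this
  norm_num at this

lemma elemI_ne_zero (i : Idx) : elemI i ≠ fun _ => 0 := fun h => by
  have := congrFun h (detState (fun _ => i.2.2.1) (fun _ => i.2.2.2))
  simp [elemI_detState] at this

lemma elemI_le_sum {A : Finset Idx} {i : Idx} (hi : i ∈ A) (P : State) :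
    elemI i P ≤ ∑ j ∈ A, elemI j P :=
  Finset.single_le_sum (f := fun j => elemI j P) (fun j _ => elemI_nonneg j P) hi

lemma elemI_le_one (i : Idx) (P : State) : elemI i P ≤ 1 := by
  have h1 := Finset.single_le_sum (f := fun β => P.1 i.1 i.2.1 i.2.2.1 β)
    (fun β _ => P.2.1 _ _ _ β) (Finset.mem_univ i.2.2.2)
  have h2 := Finset.single_le_sum (f := fun α => ∑ β, P.1 i.1 i.2.1 α β)
    (fun α _ => Finset.sum_nonneg fun β _ => P.2.1 _ _ _ β) (Finset.mem_univ i.2.2.1)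
  exact (h1.trans h2).trans (P.2.2.1 _ _).le

lemma inLogic_elemI (i : Idx) : InLogic (elemI i) :=
  Or.inl ⟨{i}, fun P => by simpa using elemI_le_one i P, by simp⟩

/-- Two distinct questions in a set with sum at most `1` refer to different outcomes of
a common measurement on one of the two sides. -/
lemma orthogonal_of_sum_le_one {A : Finset Idx} (hA : ∀ P : State, ∑ i ∈ A, elemI i P ≤ 1)
    {i j : Idx} (hi : i ∈ A) (hj : j ∈ A) (hij : i ≠ j) :
    (i.1 = j.1 ∧ i.2.2.1 ≠ j.2.2.1) ∨ (i.2.1 = j.2.1 ∧ i.2.2.2 ≠ j.2.2.2) := by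
  by_contra! hcon
  set P := detState (fun a => if a = i.1 then i.2.2.1 else j.2.2.1)
    (fun b => if b = i.2.1 then i.2.2.2 else j.2.2.2) with hP
  have hiP : elemI i P = 1 := by simp [hP, elemI_detState]
  have hjP : elemI j P = 1 := by
    rw [hP, elemI_detState, if_pos]
    constructor
    · split_ifs with h
      exacts [hcon.1 h.symm, rfl]
    · split_ifs with h
      exacts [hcon.2 h.symm, rfl]
  have hsub : ({i, j} : Finset Idx) ⊆ A := by
    intro k hk
    rcases Finset.mem_insert.1 hk with rfl | hk
    · exact hi
    · rwa [Finset.mem_singleton.1 hk]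
  have hle := Finset.sum_le_sum_of_subset_of_nonneg (f := fun k => elemI k P) hsub
    fun k _ _ => elemI_nonneg k P
  rw [Finset.sum_pair hij, hiP, hjP] at hle
  linarith [hA P]

/-- The questions obtained by measuring `a` on the left, then `c α` on the right. -/
def leftBlock (a : Fin 2) (c : Fin 2 → Fin 2) : Finset Idx :=
  Finset.univ.image fun p : Fin 2 × Fin 2 => (a, c p.1, p.1, p.2)

/-- The questions obtained by measuring `b` on the right, then `c β` on the left. -/
def rightBlock (b : Fin 2) (c : Fin 2 → Fin 2) : Finset Idx :=
  Finset.univ.image fun p : Fin 2 × Fin 2 => (c p.1, b, p.2, p.1)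

lemma sum_leftBlock (a : Fin 2) (c : Fin 2 → Fin 2) (P : State) :
    ∑ i ∈ leftBlock a c, elemI i P = 1 := by
  rw [leftBlock, Finset.sum_image (fun p _ q _ h => by
    simp only [Prod.mk.injEq] at h; exact Prod.ext h.2.2.1 h.2.2.2), Fintype.sum_prod_type]
  simp only [elemI, elem]
  rw [← P.2.2.1 a 0]
  exact Finset.sum_congr rfl fun α _ => P.2.2.2.1 a (c α) 0 α

lemma sum_rightBlock (b : Fin 2) (c : Fin 2 → Fin 2) (P : State) :
    ∑ i ∈ rightBlock b c, elemI i P = 1 := by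
  rw [rightBlock, Finset.sum_image (fun p _ q _ h => by
    simp only [Prod.mk.injEq] at h; exact Prod.ext h.2.2.2 h.2.2.1), Fintype.sum_prod_type]
  simp only [elemI, elem]
  rw [← P.2.2.1 0 b]
  exact (Finset.sum_congr rfl fun β _ => P.2.2.2.2 (c β) 0 b β).trans Finset.sum_comm

lemma exists_subset_leftBlock {A : Finset Idx} (hA : ∀ P : State, ∑ i ∈ A, elemI i P ≤ 1)
    {a : Fin 2} (ha : ∀ i ∈ A, i.1 = a) : ∃ c, A ⊆ leftBlock a c := by
  have hc : ∀ α : Fin 2, ∃ b, ∀ i ∈ A, i.2.2.1 = α → i.2.1 = b := by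
    intro α
    by_cases h : ∃ i ∈ A, i.2.2.1 = α
    · obtain ⟨i, hi, hiα⟩ := h
      refine ⟨i.2.1, fun j hj hjα => ?_⟩
      by_cases hij : i = j
      · rw [hij]
      · rcases orthogonal_of_sum_le_one hA hi hj hij with h | h
        · exact absurd (hiα.trans hjα.symm) h.2
        · exact h.1.symm
    · exact ⟨0, fun i hi hiα => absurd ⟨i, hi, hiα⟩ h⟩
  choose c hc using hc
  refine ⟨c, fun i hi => Finset.mem_image.2 ⟨(i.2.2.1, i.2.2.2), Finset.mem_univ _, ?_⟩⟩
  rw [← ha i hi, ← hc _ i hi rfl]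

lemma exists_subset_rightBlock {A : Finset Idx} (hA : ∀ P : State, ∑ i ∈ A, elemI i P ≤ 1)
    {b : Fin 2} (hb : ∀ i ∈ A, i.2.1 = b) : ∃ c, A ⊆ rightBlock b c := by
  have hc : ∀ β : Fin 2, ∃ a, ∀ i ∈ A, i.2.2.2 = β → i.1 = a := by
    intro β
    by_cases h : ∃ i ∈ A, i.2.2.2 = β
    · obtain ⟨i, hi, hiβ⟩ := h
      refine ⟨i.1, fun j hj hjβ => ?_⟩
      by_cases hij : i = j
      · rw [hij]
      · rcases orthogonal_of_sum_le_one hA hi hj hij with h | h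
        · exact h.1.symm
        · exact absurd (hiβ.trans hjβ.symm) h.2
    · exact ⟨0, fun i hi hiβ => absurd ⟨i, hi, hiβ⟩ h⟩
  choose c hc using hc
  refine ⟨c, fun i hi => Finset.mem_image.2 ⟨(i.2.2.2, i.2.2.1), Finset.mem_univ _, ?_⟩⟩
  rw [← hb i hi, ← hc _ i hi rfl]

/-- Every set of questions with sum at most `1` extends to one with sum equal to `1`. -/
lemma exists_superset_sum_eq_one {A : Finset Idx} (hA : ∀ P : State, ∑ i ∈ A, elemI i P ≤ 1) :
    ∃ M, A ⊆ M ∧ ∀ P : State, ∑ i ∈ M, elemI i P = 1 := by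
  by_cases h : ∃ a, ∀ i ∈ A, i.1 = a
  · obtain ⟨a, ha⟩ := h
    obtain ⟨c, hc⟩ := exists_subset_leftBlock hA ha
    exact ⟨_, hc, sum_leftBlock a c⟩
  · push Not at h
    obtain ⟨i, hi, -⟩ := h 0
    obtain ⟨j, hj, hji⟩ := h i.1
    have same : ∀ {k l : Idx}, k ∈ A → l ∈ A → k.1 ≠ l.1 → k.2.1 = l.2.1 := by
      intro k l hk hl hkl
      rcases orthogonal_of_sum_le_one hA hk hl (fun h => hkl (by rw [h])) with h | h
      · exact absurd h.1 hkl
      · exact h.1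
    have hb : ∀ k ∈ A, k.2.1 = i.2.1 := by
      intro k hk
      by_cases hki : k.1 = i.1
      · exact (same hk hj (by rw [hki]; exact hji.symm)).trans (same hj hi hji)
      · exact same hk hi hki
    obtain ⟨c, hc⟩ := exists_subset_rightBlock hA hb
    exact ⟨_, hc, sum_rightBlock _ c⟩

/-- Every element of the logic is a sum of elementary questions. -/
lemma InLogic.exists_eq_sum {f : State → ℝ} (hf : InLogic f) :
    ∃ A : Finset Idx, f = fun P => ∑ i ∈ A, elemI i P := by
  rcases hf with ⟨A, -, rfl⟩ | ⟨A, hA, rfl⟩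
  · exact ⟨A, rfl⟩
  · obtain ⟨M, hAM, hM⟩ := exists_superset_sum_eq_one hA
    refine ⟨M \ A, funext fun P => ?_⟩
    rw [← hM P, ← Finset.sum_sdiff hAM, add_sub_cancel_right]

lemma IsElem.exists_eq_elemI {e : State → ℝ} (he : IsElem e) : ∃ i, e = elemI i := by
  obtain ⟨a, b, α, β, rfl⟩ := he
  exact ⟨(a, b, α, β), rfl⟩

/-- the 16 elementary questions are exactly the atoms of the logic `L`:
(i) each elementary question is an atom; (ii) distinct elementary questions are
incomparable; (iii) every atom of `L` is an elementary question. -/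
theorem atoms_are_elementary :
    (∀ e : State → ℝ, IsElem e →
      e ≠ (fun _ => 0) ∧
      (∀ f : State → ℝ, InLogic f → (∀ P : State, f P ≤ e P) →
        f = (fun _ => 0) ∨ f = e)) ∧
    (∀ e e' : State → ℝ, IsElem e → IsElem e' → e ≠ e' →
      (¬ ∀ P : State, e P ≤ e' P) ∧ (¬ ∀ P : State, e' P ≤ e P)) ∧
    (∀ f : State → ℝ, InLogic f → f ≠ (fun _ => 0) →
      (∀ g : State → ℝ, InLogic g → (∀ P : State, g P ≤ f P) →
        g = (fun _ => 0) ∨ g = f) →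
      IsElem f) := by
  refine ⟨fun e he => ?_, fun e e' he he' hne => ?_, fun f hf hf0 hmin => ?_⟩
  · obtain ⟨i, rfl⟩ := he.exists_eq_elemI
    refine ⟨elemI_ne_zero i, fun f hf hle => ?_⟩
    obtain ⟨A, rfl⟩ := hf.exists_eq_sum
    have hAi : A ⊆ {i} := fun j hj =>
      Finset.mem_singleton.2 (eq_of_elemI_le fun P => (elemI_le_sum hj P).trans (hle P))
    rcases Finset.subset_singleton_iff.1 hAi with rfl | rfl
    · exact Or.inl (by simp)
    · exact Or.inr (by simp)
  · obtain ⟨i, rfl⟩ := he.exists_eq_elemI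
    obtain ⟨j, rfl⟩ := he'.exists_eq_elemI
    exact ⟨fun h => hne (by rw [eq_of_elemI_le h]), fun h => hne (by rw [eq_of_elemI_le h])⟩
  · obtain ⟨A, rfl⟩ := hf.exists_eq_sum
    rcases A.eq_empty_or_nonempty with rfl | ⟨i, hi⟩
    · exact absurd (by simp) hf0
    · rcases hmin _ (inLogic_elemI i) (elemI_le_sum hi) with h | h
      · exact absurd h (elemI_ne_zero i)
      · exact ⟨i.1, i.2.1, i.2.2.1, i.2.2.2, h.symm⟩

end BoxWorld
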